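/- arXiv:2402.11639 — 2 statements merged into one kernel-verified Lean document; each statement's English description precedes it below -/
import Mathlib

section
/- (Signal term, ReLU tasks, upper bound.) There exists a constant C > 0 depending only on d such that: (i) for every w ≥ 0 and every L > 0, L_b(w; D(F^+_L)) ≤ 4L²; and (ii) if w ≥ (d+√d)/2, n > 5, and 45·√d·w^{d/2} ≤ n/log n, then L_b(w; D(F^+_L)) ≤ C·L²·( 1/w + 1/n ). -/
open MeasureTheory Real

noncomputable section

/-- Uniform probability measure on the unit sphere `S^{d-1} ⊆ ℝ^d`, defined as the
normalized `(d-1)`-dimensional Hausdorff measure restricted to the sphere. -/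
def sphereUniform (d : ℕ) : Measure (EuclideanSpace ℝ (Fin d)) :=
  ((μH[(d : ℝ) - 1]) (Metric.sphere (0 : EuclideanSpace ℝ (Fin d)) 1))⁻¹ •
    (μH[(d : ℝ) - 1]).restrict (Metric.sphere (0 : EuclideanSpace ℝ (Fin d)) 1)

/-- Uniform probability measure on the interval `[-L, L]`. -/
def unifIcc (L : ℝ) : Measure ℝ :=
  (ENNReal.ofReal (2 * L))⁻¹ • (volume.restrict (Set.Icc (-L) L))

/-- The softmax attention weight
`γ_i(w) = exp(-w ‖x_i - x_{n+1}‖²) / Σ_j exp(-w ‖x_j - x_{n+1}‖²)`. -/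
def attnW {d n : ℕ} (w : ℝ) (x : Fin (n + 1) → EuclideanSpace ℝ (Fin d)) (i : Fin n) : ℝ :=
  Real.exp (-w * ‖x i.castSucc - x (Fin.last n)‖ ^ 2) /
    ∑ j : Fin n, Real.exp (-w * ‖x j.castSucc - x (Fin.last n)‖ ^ 2)

/-- The signal (bias) term `L_b(w; D)`: the task parameter `θ` is drawn from `τ`
(with task function `F θ`) and the covariates `x_1, …, x_{n+1}` are i.i.d. uniform
on the sphere. -/
def signalTerm (d n : ℕ) {Θ : Type*} [MeasurableSpace Θ] (τ : Measure Θ)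
    (F : Θ → EuclideanSpace ℝ (Fin d) → ℝ) (w : ℝ) : ℝ :=
  ∫ θ, ∫ x : Fin (n + 1) → EuclideanSpace ℝ (Fin d),
      (∑ i : Fin n, attnW w x i * (F θ (x (Fin.last n)) - F θ (x i.castSucc))) ^ 2
    ∂(Measure.pi fun _ : Fin (n + 1) => sphereUniform d) ∂τ

/-- The parameter distribution of the affine task class `D(F^aff_L)`:
`v` uniform on the sphere, `l, b` i.i.d. uniform on `[-L, L]`. -/
def affineTask (d : ℕ) (L : ℝ) : Measure (EuclideanSpace ℝ (Fin d) × ℝ × ℝ) :=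
  (sphereUniform d).prod ((unifIcc L).prod (unifIcc L))

/-- The affine task function `f(x) = l ⬝ vᵀx + b` with parameter `θ = (v, l, b)`. -/
def affineF {d : ℕ} (θ : EuclideanSpace ℝ (Fin d) × ℝ × ℝ)
    (x : EuclideanSpace ℝ (Fin d)) : ℝ :=
  θ.2.1 * (∑ a, θ.1 a * x a) + θ.2.2

/-- The parameter distribution of the ReLU task class `D(F^+_L)`. -/
def reluTask (d : ℕ) (L : ℝ) : Measure (EuclideanSpace ℝ (Fin d) × ℝ × ℝ × ℝ) :=
  (sphereUniform d).prod ((unifIcc L).prod ((unifIcc L).prod (unifIcc L)))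

/-- The ReLU task function `f(x) = l₁ max(vᵀx, 0) + l₂ max(-vᵀx, 0) + b`. -/
def reluF {d : ℕ} (θ : EuclideanSpace ℝ (Fin d) × ℝ × ℝ × ℝ)
    (x : EuclideanSpace ℝ (Fin d)) : ℝ :=
  θ.2.1 * max (∑ a, θ.1 a * x a) 0 + θ.2.2.1 * max (-(∑ a, θ.1 a * x a)) 0 + θ.2.2.2

theorem sphereUniform_eq_zero_or_isProbabilityMeasure (d : ℕ) :
    sphereUniform d = 0 ∨ IsProbabilityMeasure (sphereUniform d) := by
  set h := (μH[(d : ℝ) - 1]) (Metric.sphere (0 : EuclideanSpace ℝ (Fin d)) 1) with hh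
  by_cases h0 : h = 0
  · left
    rw [sphereUniform, Measure.restrict_eq_zero.2 (hh ▸ h0), smul_zero]
  by_cases h1 : h = ⊤
  · left
    rw [sphereUniform, ← hh, h1, ENNReal.inv_top, zero_smul]
  · right
    constructor
    rw [sphereUniform, ← hh, Measure.smul_apply, Measure.restrict_apply_univ, ← hh, smul_eq_mul,
      ENNReal.inv_mul_cancel h0 h1]

theorem ae_norm_eq_one_sphereUniform (d : ℕ) : ∀ᵐ x ∂sphereUniform d, ‖x‖ = 1 := by
  refine Measure.ae_smul_measure ?_ _
  filter_upwards [ae_restrict_mem (Metric.isClosed_sphere.measurableSet)] with x hx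
  simpa using hx

theorem map_linearIsometryEquiv_sphereUniform {d : ℕ}
    (e : EuclideanSpace ℝ (Fin d) ≃ₗᵢ[ℝ] EuclideanSpace ℝ (Fin d)) :
    (sphereUniform d).map e = sphereUniform d := by
  have hS : e ⁻¹' (Metric.sphere 0 1) = Metric.sphere (0 : EuclideanSpace ℝ (Fin d)) 1 := by
    ext x; simp
  have hm : Measurable e := e.continuous.measurable
  have := e.toIsometryEquiv.map_hausdorffMeasure ((d : ℝ) - 1)
  have he : ⇑e.toIsometryEquiv = e := rfl
  rw [he] at this
  rw [sphereUniform, Measure.map_smul]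
  congr 1
  conv_lhs => rw [← hS]
  rw [← Measure.restrict_map hm Metric.isClosed_sphere.measurableSet, this]

/-- All balls of a given radius centred on the unit sphere have the same mass. -/
theorem sphereUniform_closedBall_eq {d : ℕ} {x y : EuclideanSpace ℝ (Fin d)} (h : ‖x‖ = ‖y‖)
    (r : ℝ) : sphereUniform d (Metric.closedBall x r) = sphereUniform d (Metric.closedBall y r) := by
  set e := (Submodule.span ℝ {x - y})ᗮ.reflection
  have hxy : e x = y := Submodule.reflection_sub h
  have hB : e ⁻¹' (Metric.closedBall y r) = Metric.closedBall x r := by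
    rw [← hxy]; ext z; simp
  rw [← hB, ← Measure.map_apply e.continuous.measurable Metric.isClosed_closedBall.measurableSet,
    map_linearIsometryEquiv_sphereUniform]

/-- Comparison of ball masses for a measure supported on the unit sphere, by double counting with
Lebesgue measure. -/
theorem measure_closedBall_mul_le {d : ℕ} (hd : d ≠ 0) (μ : Measure (EuclideanSpace ℝ (Fin d)))
    [SFinite μ] (hμ : ∀ᵐ x ∂μ, ‖x‖ = 1) {r R : ℝ} (hr : 0 < r) (hR : 0 ≤ R) {M : ENNReal}
    (hM : ∀ y, ‖y‖ = 1 → μ (Metric.closedBall y r) ≤ M) (y : EuclideanSpace ℝ (Fin d)) :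
    μ (Metric.closedBall y R) * ENNReal.ofReal ((r / 2) ^ d) ≤
      M * ENNReal.ofReal ((R + r / 2) ^ d) := by
  have : Nonempty (Fin d) := ⟨⟨0, Nat.pos_of_ne_zero hd⟩⟩
  set ν : Measure (EuclideanSpace ℝ (Fin d)) := volume
  set c := ν (Metric.ball 0 1)
  have hc0 : c ≠ 0 := (Metric.measure_ball_pos ν 0 one_pos).ne'
  have hc1 : c ≠ ⊤ := measure_ball_lt_top.ne
  have hvol : ∀ (z : EuclideanSpace ℝ (Fin d)) (s : ℝ), 0 ≤ s →
      ν (Metric.closedBall z s) = ENNReal.ofReal (s ^ d) * c := fun z s hs => by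
    rw [Measure.addHaar_closedBall ν z hs, finrank_euclideanSpace_fin]
  set B := Metric.closedBall y R
  set K : EuclideanSpace ℝ (Fin d) → EuclideanSpace ℝ (Fin d) → ENNReal :=
    fun x z => {p : EuclideanSpace ℝ (Fin d) × EuclideanSpace ℝ (Fin d) |
      dist p.1 p.2 ≤ r / 2}.indicator (fun _ => 1) (x, z)
  have hKm : MeasurableSet {p : EuclideanSpace ℝ (Fin d) × EuclideanSpace ℝ (Fin d) |
      dist p.1 p.2 ≤ r / 2} := (isClosed_le continuous_dist continuous_const).measurableSet
  have hL : ∫⁻ x in B, ∫⁻ z, K x z ∂ν ∂μ = ENNReal.ofReal ((r / 2) ^ d) * c * μ B := by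
    have : ∀ x, ∫⁻ z, K x z ∂ν = ENNReal.ofReal ((r / 2) ^ d) * c := fun x => by
      rw [← hvol x _ (by positivity),
        ← lintegral_indicator_one Metric.isClosed_closedBall.measurableSet]
      refine lintegral_congr fun z => ?_
      simp [K, Set.indicator, dist_comm]
    simp only [this, lintegral_const, Measure.restrict_apply_univ]
  have hswap : ∫⁻ x in B, ∫⁻ z, K x z ∂ν ∂μ = ∫⁻ z, ∫⁻ x in B, K x z ∂μ ∂ν :=
    lintegral_lintegral_swap (measurable_const.indicator hKm).aemeasurable
  have hU : ∀ z, ∫⁻ x in B, K x z ∂μ ≤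
      (Metric.closedBall y (R + r / 2)).indicator (fun _ => M) z := by
    intro z
    have h1 : ∫⁻ x in B, K x z ∂μ = μ (Metric.closedBall z (r / 2) ∩ B) := by
      rw [← Measure.restrict_apply Metric.isClosed_closedBall.measurableSet,
        ← lintegral_indicator_one Metric.isClosed_closedBall.measurableSet]
      refine lintegral_congr fun x => ?_
      simp [K, Set.indicator]
    rw [h1]
    by_cases hz : z ∈ Metric.closedBall y (R + r / 2)
    · rw [Set.indicator_of_mem hz]
      by_cases hs : ∃ s, ‖s‖ = 1 ∧ s ∈ Metric.closedBall z (r / 2)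
      · obtain ⟨s, hs1, hs2⟩ := hs
        refine (measure_mono ?_).trans (hM s hs1)
        intro x hx
        have h2 := hx.1
        rw [Metric.mem_closedBall] at *
        linarith [dist_triangle_right x s z]
      · push Not at hs
        have : μ (Metric.closedBall z (r / 2) ∩ B) = 0 := by
          refine measure_mono_null ?_ (ae_iff.1 hμ)
          intro x hx hx1
          exact hs x hx1 hx.1
        rw [this]; exact zero_le
    · have : Metric.closedBall z (r / 2) ∩ B = ∅ := by
        ext x
        simp only [Set.mem_inter_iff, Set.mem_empty_iff_false, iff_false, not_and, B,
          Metric.mem_closedBall] at hz ⊢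
        intro h2 h3
        apply hz
        linarith [dist_triangle_left z y x]
      simp [this]
  have hfin : ENNReal.ofReal ((r / 2) ^ d) * c * μ B ≤
      M * (ENNReal.ofReal ((R + r / 2) ^ d) * c) := by
    rw [← hL, hswap, ← hvol y _ (by positivity)]
    refine (lintegral_mono hU).trans ?_
    rw [lintegral_indicator_const Metric.isClosed_closedBall.measurableSet]
  refine (ENNReal.mul_le_mul_iff_left hc0 hc1).1 ?_
  calc _ = ENNReal.ofReal ((r / 2) ^ d) * c * μ B := by ring
    _ ≤ _ := hfin
    _ = _ := by ring

theorem sphereUniform_closedBall_le_mul {d : ℕ} (hd : d ≠ 0) [SFinite (sphereUniform d)]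
    {r R : ℝ} (hr : 0 < r) (hR : 0 ≤ R) {y : EuclideanSpace ℝ (Fin d)} (hy : ‖y‖ = 1) :
    sphereUniform d (Metric.closedBall y R) ≤
      ENNReal.ofReal ((1 + 2 * R / r) ^ d) * sphereUniform d (Metric.closedBall y r) := by
  have h := measure_closedBall_mul_le hd (sphereUniform d) (ae_norm_eq_one_sphereUniform d) hr hR
    (fun z hz => (sphereUniform_closedBall_eq (hz.trans hy.symm) r).le) y
  have h2 : (R + r / 2) ^ d = (1 + 2 * R / r) ^ d * (r / 2) ^ d := by
    rw [← mul_pow]; congr 1; field_simp; ring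
  rw [h2, ENNReal.ofReal_mul (by positivity), ← mul_assoc] at h
  have h3 : ENNReal.ofReal ((r / 2) ^ d) ≠ 0 := by
    rw [ne_eq, ENNReal.ofReal_eq_zero, not_le]; positivity
  rw [mul_comm (ENNReal.ofReal _)]
  exact (ENNReal.mul_le_mul_iff_left h3 ENNReal.ofReal_ne_top).1 h

/-- If `N` counts how many of the remaining points lie in `A`, then the leave-one-out sum of
`a (x i) / (1 + N)` has expectation at most `E[a] / μ(A)`. -/
theorem lintegral_sum_leaveOneOut_mul_le {α : Type*} [MeasurableSpace α] (μ : Measure α)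
    [IsProbabilityMeasure μ] {A : Set α} (hA : MeasurableSet A) {a : α → ENNReal}
    (ha : Measurable a) (m : ℕ) :
    (∫⁻ x : Fin (m + 1) → α, ∑ i, a (x i) *
        (1 + ∑ j : Fin m, A.indicator 1 (x (i.succAbove j)))⁻¹ ∂(Measure.pi fun _ => μ)) * μ A ≤
      ∫⁻ u, a u ∂μ := by
  set Q : (Fin m → α) → ENNReal := fun x => (1 + ∑ j : Fin m, A.indicator 1 (x j))⁻¹
  have hind : Measurable (A.indicator (1 : α → ENNReal)) := measurable_one.indicator hA
  have hQ : Measurable Q := by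
    refine Measurable.inv (Measurable.const_add ?_ 1)
    exact Finset.measurable_sum _ fun j _ => hind.comp (measurable_pi_apply j)
  have key : ∀ b : α → ENNReal, Measurable b →
      ∫⁻ x : Fin (m + 1) → α, ∑ i, b (x i) * Q (fun j => x (i.succAbove j))
        ∂(Measure.pi fun _ => μ) =
      (∫⁻ u, b u ∂μ) * ((m + 1 : ℕ) * ∫⁻ x, Q x ∂(Measure.pi fun _ => μ)) := by
    intro b hb
    rw [lintegral_finsetSum]
    · have : ∀ i : Fin (m + 1), ∫⁻ x : Fin (m + 1) → α, b (x i) * Q (fun j => x (i.succAbove j))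
          ∂(Measure.pi fun _ => μ) = (∫⁻ u, b u ∂μ) * ∫⁻ x, Q x ∂(Measure.pi fun _ => μ) := by
        intro i
        have h := (measurePreserving_piFinSuccAbove (fun _ : Fin (m + 1) => μ) i).lintegral_comp
          (f := fun p : α × (Fin m → α) => b p.1 * Q p.2) (by fun_prop)
        rw [lintegral_prod_mul hb.aemeasurable hQ.aemeasurable] at h
        exact h
      simp only [this, Finset.sum_const, Finset.card_univ, Fintype.card_fin, nsmul_eq_mul]
      ring
    · intro i _
      fun_prop
  have hA1 : ∫⁻ x : Fin (m + 1) → α, ∑ i, A.indicator 1 (x i) * Q (fun j => x (i.succAbove j))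
        ∂(Measure.pi fun _ => μ) ≤ 1 := by
    refine (lintegral_mono (g := fun _ => 1) fun x => ?_).trans (by simp)
    set B : ENNReal := ∑ i, A.indicator 1 (x i)
    have hterm : ∀ i, A.indicator 1 (x i) * Q (fun j => x (i.succAbove j)) =
        A.indicator 1 (x i) * B⁻¹ := by
      intro i
      by_cases hi : x i ∈ A
      · simp only [Q, B]
        rw [Fin.sum_univ_succAbove _ i, Set.indicator_of_mem hi]
        simp
      · simp [Set.indicator_of_notMem hi]
    simp only [hterm]
    rw [← Finset.sum_mul]
    exact ENNReal.mul_inv_le_one _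
  rw [key _ hind, lintegral_indicator_one hA] at hA1
  have := key a ha
  simp only [Q] at this
  rw [this]
  calc _ = (∫⁻ u, a u ∂μ) * (μ A * ((m + 1 : ℕ) * ∫⁻ x, Q x ∂(Measure.pi fun _ => μ))) := by
        simp only [Q]; ring
    _ ≤ (∫⁻ u, a u ∂μ) * 1 := by gcongr
    _ = _ := mul_one _

open Classical in
/-- A Gibbs average of numbers in `[0, M]` is controlled by a threshold `ρ`, the event that no
number is below `ρ`, and a leave-one-out sum. -/
theorem gibbs_average_le {m : ℕ} (t : Fin (m + 1) → ℝ) (w ρ M : ℝ) (hw : 0 ≤ w) (hρ : 0 ≤ ρ)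
    (ht : ∀ i, 0 ≤ t i) (htM : ∀ i, t i ≤ M) :
    ∑ i, exp (-w * t i) / (∑ j, exp (-w * t j)) * t i ≤
      ρ + (if ∀ i, ρ < t i then M else 0) +
      ∑ i, 2 * exp (w * ρ) * (t i * exp (-w * t i)) *
        (1 + ∑ j : Fin m, if t (i.succAbove j) ≤ ρ then (1 : ℝ) else 0)⁻¹ := by
  set Z := ∑ j, exp (-w * t j)
  have hZ : 0 < Z := Finset.sum_pos (fun i _ => exp_pos _) Finset.univ_nonempty
  have hsum : ∑ i, exp (-w * t i) / Z = 1 := by rw [← Finset.sum_div, div_self hZ.ne']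
  have hN : ∀ i : Fin (m + 1), 0 ≤ ∑ j : Fin m, if t (i.succAbove j) ≤ ρ then (1 : ℝ) else 0 :=
    fun i => Finset.sum_nonneg fun j _ => by split_ifs <;> norm_num
  have hlast : ∀ i : Fin (m + 1), 0 ≤ 2 * exp (w * ρ) * (t i * exp (-w * t i)) *
        (1 + ∑ j : Fin m, if t (i.succAbove j) ≤ ρ then (1 : ℝ) else 0)⁻¹ := fun i => by
    have := hN i
    have := ht i
    positivity
  by_cases hall : ∀ i, ρ < t i
  · rw [if_pos hall]
    have h1 : ∑ i, exp (-w * t i) / Z * t i ≤ M := by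
      calc _ ≤ ∑ i, exp (-w * t i) / Z * M := by
            gcongr with i _
            exact htM i
        _ = M := by rw [← Finset.sum_mul, hsum, one_mul]
    have := Finset.sum_nonneg fun i (_ : i ∈ Finset.univ) => hlast i
    linarith
  · rw [if_neg hall, add_zero]
    push Not at hall
    obtain ⟨k, hk⟩ := hall
    have hterm : ∀ i, exp (-w * t i) / Z * t i ≤ exp (-w * t i) / Z * ρ +
        2 * exp (w * ρ) * (t i * exp (-w * t i)) *
        (1 + ∑ j : Fin m, if t (i.succAbove j) ≤ ρ then (1 : ℝ) else 0)⁻¹ := by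
      intro i
      by_cases hi : t i ≤ ρ
      · have : exp (-w * t i) / Z * t i ≤ exp (-w * t i) / Z * ρ := by gcongr
        linarith [hlast i]
      · set N := ∑ j : Fin m, if t (i.succAbove j) ≤ ρ then (1 : ℝ) else 0 with hNdef
        have hN1 : 1 ≤ N := by
          obtain ⟨j, hj⟩ := Fin.exists_succAbove_eq (x := k) (y := i) (by rintro rfl; exact hi hk)
          have := Finset.single_le_sum
            (f := fun j : Fin m => if t (i.succAbove j) ≤ ρ then (1 : ℝ) else 0)
            (fun j _ => by split_ifs <;> norm_num) (Finset.mem_univ j)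
          rwa [hj, if_pos hk] at this
        have hZN : exp (-(w * ρ)) * N ≤ Z := by
          simp only [Z, hNdef]
          rw [Fin.sum_univ_succAbove _ i, Finset.mul_sum]
          refine (Finset.sum_le_sum fun j _ => ?_).trans (le_add_of_nonneg_left (exp_pos _).le)
          split_ifs with hj
          · rw [mul_one, exp_le_exp, neg_mul, neg_le_neg_iff]
            gcongr
          · rw [mul_zero]; positivity
        have hZinv : Z⁻¹ ≤ 2 * exp (w * ρ) * (1 + N)⁻¹ := by
          rw [← div_eq_mul_inv, inv_le_comm₀ hZ (by positivity), inv_div]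
          refine le_trans ?_ hZN
          rw [exp_neg, div_le_iff₀ (by positivity)]
          field_simp
          linarith
        have := mul_le_mul_of_nonneg_left hZinv
          (mul_nonneg (ht i) (exp_pos (-w * t i)).le)
        have h0 : 0 ≤ exp (-w * t i) / Z * ρ := by positivity
        calc _ = t i * exp (-w * t i) * Z⁻¹ := by field_simp
          _ ≤ _ := this
          _ ≤ _ := by linarith
    refine (Finset.sum_le_sum fun i _ => hterm i).trans ?_
    rw [Finset.sum_add_distrib, ← Finset.sum_mul, hsum, one_mul]

theorem mul_exp_neg_le_tsum {d : ℕ} {w : ℝ} (hw : 0 < w) (x y : EuclideanSpace ℝ (Fin d)) :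
    ENNReal.ofReal (‖x - y‖ ^ 2 * exp (-w * ‖x - y‖ ^ 2)) ≤
      ∑' k : ℕ, (Metric.closedBall y ((k + 1) / √w)).indicator
        (fun _ => ENNReal.ofReal ((k + 1) * exp (-k) / w)) x := by
  set s := w * ‖x - y‖ ^ 2
  have hs : 0 ≤ s := by positivity
  set k := ⌊s⌋₊
  have hk1 : (k : ℝ) ≤ s := Nat.floor_le hs
  have hk2 : s < k + 1 := Nat.lt_floor_add_one s
  have hmem : x ∈ Metric.closedBall y ((k + 1) / √w) := by
    rw [mem_closedBall_iff_norm, le_div_iff₀ (sqrt_pos.2 hw)]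
    refine abs_le_of_sq_le_sq' ?_ (by positivity) |>.2
    rw [mul_pow, sq_sqrt hw.le]
    nlinarith [(Nat.cast_nonneg k : (0 : ℝ) ≤ k)]
  refine le_trans ?_ (ENNReal.le_tsum k)
  rw [Set.indicator_of_mem hmem]
  refine ENNReal.ofReal_le_ofReal ?_
  have h1 : ‖x - y‖ ^ 2 = s / w := by simp only [s]; field_simp
  have h2 : -w * ‖x - y‖ ^ 2 = -s := by simp only [s]; ring
  rw [h2, h1, div_mul_eq_mul_div]
  gcongr

theorem summable_shell_weights (d : ℕ) :
    Summable fun k : ℕ => ((k : ℝ) + 1) * exp (-k) * (k + 2) ^ d := by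
  have h := (summable_nat_add_iff 2).2 (summable_pow_mul_exp_neg_nat_mul (d + 1) one_pos)
  refine Summable.of_nonneg_of_le (fun k => by positivity) (fun k => ?_) (h.mul_left (exp 2))
  push_cast
  have : exp (-1 * ((k : ℝ) + 2)) = exp (-k) * exp (-2) := by rw [← exp_add]; ring_nf
  rw [this, pow_succ]
  have h3 : exp 2 * exp (-2) = 1 := by rw [← exp_add]; simp
  calc _ ≤ ((k : ℝ) + 2) * exp (-k) * (k + 2) ^ d := by gcongr; norm_num
    _ = (exp 2 * exp (-2)) * ((k + 2) * exp (-k) * (k + 2) ^ d) := by rw [h3, one_mul]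
    _ = _ := by ring

theorem lintegral_mul_exp_neg_le {d : ℕ} (hd : d ≠ 0) [IsProbabilityMeasure (sphereUniform d)]
    {w : ℝ} (hw : 0 < w) {y : EuclideanSpace ℝ (Fin d)} (hy : ‖y‖ = 1) :
    ∫⁻ x, ENNReal.ofReal (‖x - y‖ ^ 2 * exp (-w * ‖x - y‖ ^ 2)) ∂(sphereUniform d) ≤
      ENNReal.ofReal ((∑' k : ℕ, ((k : ℝ) + 1) * exp (-k) * (k + 2) ^ d) / w) *
        sphereUniform d (Metric.closedBall y (20 / √w)) := by
  have hsw : 0 < √w := sqrt_pos.2 hw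
  refine (lintegral_mono fun x => mul_exp_neg_le_tsum hw x y).trans ?_
  rw [lintegral_tsum fun k =>
    (measurable_const.indicator Metric.isClosed_closedBall.measurableSet).aemeasurable]
  simp only [lintegral_indicator_const Metric.isClosed_closedBall.measurableSet]
  rw [← tsum_div_const, ENNReal.ofReal_tsum_of_nonneg (fun k => by positivity)
    ((summable_shell_weights d).div_const w), ← ENNReal.tsum_mul_right]
  refine ENNReal.tsum_le_tsum fun k => ?_
  have h := sphereUniform_closedBall_le_mul hd (r := 20 / √w) (R := (k + 1) / √w)
    (by positivity) (by positivity) hy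
  have h2 : (1 + 2 * ((k + 1) / √w) / (20 / √w)) ^ d ≤ ((k : ℝ) + 2) ^ d := by
    have : 2 * (((k : ℝ) + 1) / √w) / (20 / √w) = (k + 1) / 10 := by field_simp; norm_num
    rw [this]
    refine pow_le_pow_left₀ (by positivity) ?_ d
    linarith [(Nat.cast_nonneg k : (0 : ℝ) ≤ k)]
  calc _ ≤ ENNReal.ofReal ((k + 1) * exp (-k) / w) * (ENNReal.ofReal (((k : ℝ) + 2) ^ d) *
        sphereUniform d (Metric.closedBall y (20 / √w))) := by
        gcongr
        exact h.trans (by gcongr)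
    _ = _ := by
        rw [← mul_assoc, ← ENNReal.ofReal_mul (by positivity)]
        congr 2
        ring

theorem rpow_neg_le_sphereUniform_closedBall {d : ℕ} (hd : d ≠ 0)
    [IsProbabilityMeasure (sphereUniform d)] {w : ℝ} (hw : 25 / 16 ≤ w)
    {y : EuclideanSpace ℝ (Fin d)} (hy : ‖y‖ = 1) :
    (w ^ ((d : ℝ) / 2))⁻¹ ≤ (sphereUniform d).real (Metric.closedBall y (20 / √w)) := by
  have hw0 : 0 < w := by linarith
  have hsw : 5 / 4 ≤ √w := le_sqrt_of_sq_le (by linarith)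
  have h := sphereUniform_closedBall_le_mul hd (r := 20 / √w) (R := 2)
    (by positivity) (by norm_num) hy
  have h1 : sphereUniform d (Metric.closedBall y 2) = 1 := by
    rw [prob_compl_eq_zero_iff Metric.isClosed_closedBall.measurableSet |>.symm]
    refine measure_mono_null ?_ (ae_iff.1 (ae_norm_eq_one_sphereUniform d))
    intro x hx hx1
    apply hx
    rw [mem_closedBall_iff_norm]
    linarith [norm_sub_le x y]
  have h2 : (1 + 2 * 2 / (20 / √w)) ^ d ≤ w ^ ((d : ℝ) / 2) := by
    have : w ^ ((d : ℝ) / 2) = √w ^ d := by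
      rw [sqrt_eq_rpow, ← rpow_natCast, ← rpow_mul hw0.le]; ring_nf
    rw [this]
    have h3 : 2 * 2 / (20 / √w) = √w / 5 := by field_simp; norm_num
    rw [h3]
    gcongr
    linarith
  rw [h1] at h
  have h4 := ENNReal.toReal_mono (ENNReal.mul_ne_top ENNReal.ofReal_ne_top (measure_ne_top _ _)) h
  rw [ENNReal.toReal_mul, ENNReal.toReal_ofReal (by positivity), ENNReal.toReal_one] at h4
  rw [inv_le_iff_one_le_mul₀ (by positivity), mul_comm]
  refine h4.trans ?_
  exact mul_le_mul_of_nonneg_right h2 ENNReal.toReal_nonneg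

theorem one_sub_pow_le_inv {p : ℝ} {n : ℕ} (hn : 0 < n) (hp1 : p ≤ 1) (h : Real.log n ≤ p * n) :
    (1 - p) ^ n ≤ (n : ℝ)⁻¹ := by
  have hn' : (0 : ℝ) < n := by exact_mod_cast hn
  calc (1 - p) ^ n ≤ exp (-p) ^ n := by
        refine pow_le_pow_left₀ (by linarith) ?_ n
        linarith [add_one_le_exp (-p)]
    _ = exp (-(p * n)) := by rw [← exp_nat_mul]; ring_nf
    _ ≤ exp (-Real.log n) := by gcongr
    _ = (n : ℝ)⁻¹ := by rw [exp_neg, exp_log hn']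

/-- The expected attention-weighted squared distance to a fixed query point on the sphere. -/
theorem lintegral_gibbs_average_le {d : ℕ} (hd : d ≠ 0) [IsProbabilityMeasure (sphereUniform d)]
    {w : ℝ} (hw : 25 / 16 ≤ w) {m : ℕ}
    (hn : w ^ ((d : ℝ) / 2) * Real.log (m + 1 : ℕ) ≤ (m + 1 : ℕ))
    {y : EuclideanSpace ℝ (Fin d)} (hy : ‖y‖ = 1) :
    ∫⁻ x : Fin (m + 1) → EuclideanSpace ℝ (Fin d), ENNReal.ofReal
        (∑ i, exp (-w * ‖x i - y‖ ^ 2) / (∑ j, exp (-w * ‖x j - y‖ ^ 2)) * ‖x i - y‖ ^ 2)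
        ∂(Measure.pi fun _ => sphereUniform d) ≤
      ENNReal.ofReal (400 / w + 4 * ((m + 1 : ℕ) : ℝ)⁻¹ + 2 * exp 400 *
        ((∑' k : ℕ, ((k : ℝ) + 1) * exp (-k) * (k + 2) ^ d) / w)) := by
  have hw0 : 0 < w := by linarith
  have hsw : 0 < √w := sqrt_pos.2 hw0
  set μ := sphereUniform d
  set S := ∑' k : ℕ, ((k : ℝ) + 1) * exp (-k) * (k + 2) ^ d
  have hS : 0 ≤ S := tsum_nonneg fun k => by positivity
  set A := Metric.closedBall y (20 / √w)
  have hA : MeasurableSet A := Metric.isClosed_closedBall.measurableSet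
  have hmemA : ∀ u, u ∈ A ↔ ‖u - y‖ ^ 2 ≤ 400 / w := by
    intro u
    rw [mem_closedBall_iff_norm, ← sq_le_sq₀ (norm_nonneg _) (by positivity), div_pow,
      sq_sqrt hw0.le]
    norm_num
  have hpA := rpow_neg_le_sphereUniform_closedBall hd hw hy
  have hwd : 0 < w ^ ((d : ℝ) / 2) := rpow_pos_of_pos hw0 _
  have hpA0 : 0 < μ.real A := lt_of_lt_of_le (inv_pos.2 hwd) hpA
  have hA0 : μ A ≠ 0 := fun h => by simp [Measure.real, h] at hpA0
  set a : EuclideanSpace ℝ (Fin d) → ENNReal := fun u =>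
    ENNReal.ofReal (2 * exp 400 * (‖u - y‖ ^ 2 * exp (-w * ‖u - y‖ ^ 2)))
  have ha : Measurable a := by fun_prop
  set T : Set (Fin (m + 1) → EuclideanSpace ℝ (Fin d)) := Set.univ.pi fun _ => Aᶜ
  have hT : MeasurableSet T := MeasurableSet.univ_pi fun _ => hA.compl
  have hpt : ∀ᵐ x ∂(Measure.pi fun _ : Fin (m + 1) => μ), ENNReal.ofReal
        (∑ i, exp (-w * ‖x i - y‖ ^ 2) / (∑ j, exp (-w * ‖x j - y‖ ^ 2)) * ‖x i - y‖ ^ 2) ≤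
      ENNReal.ofReal (400 / w) + T.indicator (fun _ => ENNReal.ofReal 4) x +
      ∑ i, a (x i) * (1 + ∑ j : Fin m, A.indicator 1 (x (i.succAbove j)))⁻¹ := by
    have hae : ∀ᵐ x ∂(Measure.pi fun _ : Fin (m + 1) => μ), ∀ i, ‖x i‖ = 1 := by
      rw [ae_all_iff]
      intro i
      exact (Measure.tendsto_eval_ae_ae (μ := fun _ : Fin (m + 1) => μ) (i := i)).eventually
        (ae_norm_eq_one_sphereUniform d)
    filter_upwards [hae] with x hx
    have h4 : ∀ i, ‖x i - y‖ ^ 2 ≤ 4 := fun i => by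
      have := norm_sub_le (x i) y
      rw [hx i, hy] at this
      nlinarith [norm_nonneg (x i - y)]
    have h := gibbs_average_le (fun i => ‖x i - y‖ ^ 2) w (400 / w) 4 hw0.le (by positivity)
      (fun i => by positivity) h4
    have hN : ∀ i : Fin (m + 1), (0 : ℝ) ≤
        ∑ j : Fin m, if ‖x (i.succAbove j) - y‖ ^ 2 ≤ 400 / w then (1 : ℝ) else 0 :=
      fun i => Finset.sum_nonneg fun j _ => by split_ifs <;> norm_num
    refine (ENNReal.ofReal_le_ofReal h).trans ?_
    refine ENNReal.ofReal_add_le.trans (add_le_add (ENNReal.ofReal_add_le.trans ?_) ?_)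
    · gcongr
      by_cases hx : x ∈ T
      · rw [Set.indicator_of_mem hx]
        refine ENNReal.ofReal_le_ofReal ?_
        split_ifs <;> norm_num
      · rw [if_neg]
        · simp
        · intro h'
          apply hx
          intro i _
          simp only [Set.mem_compl_iff, hmemA, not_le]
          exact h' i
    · have hww : w * (400 / w) = 400 := by field_simp
      rw [hww, ENNReal.ofReal_sum_of_nonneg fun i _ => by have := hN i; positivity]
      refine Finset.sum_le_sum fun i _ => ?_
      have hNi := hN i
      rw [ENNReal.ofReal_mul (by positivity), ENNReal.ofReal_inv_of_pos (by positivity),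
        ENNReal.ofReal_add zero_le_one hNi, ENNReal.ofReal_one,
        ENNReal.ofReal_sum_of_nonneg fun j _ => by split_ifs <;> norm_num]
      refine le_of_eq ?_
      congr 3
      refine Finset.sum_congr rfl fun j _ => ?_
      simp only [Set.indicator, hmemA]
      split_ifs <;> simp
  have hPT : ∫⁻ x, T.indicator (fun _ => ENNReal.ofReal 4) x
      ∂(Measure.pi fun _ : Fin (m + 1) => μ) ≤ ENNReal.ofReal (4 * ((m + 1 : ℕ) : ℝ)⁻¹) := by
    rw [lintegral_indicator_const hT, Measure.pi_pi, Finset.prod_const, Finset.card_univ,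
      Fintype.card_fin, ENNReal.ofReal_mul (by norm_num)]
    gcongr
    rw [← ofReal_measureReal, ← ENNReal.ofReal_pow measureReal_nonneg,
      probReal_compl_eq_one_sub hA]
    refine ENNReal.ofReal_le_ofReal (one_sub_pow_le_inv m.succ_pos measureReal_le_one ?_)
    calc Real.log (m + 1 : ℕ) = (w ^ ((d : ℝ) / 2))⁻¹ *
          (w ^ ((d : ℝ) / 2) * Real.log (m + 1 : ℕ)) := by field_simp
      _ ≤ μ.real A * (m + 1 : ℕ) := by
        gcongr
  have hsum : ∫⁻ x : Fin (m + 1) → EuclideanSpace ℝ (Fin d),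
      ∑ i, a (x i) * (1 + ∑ j : Fin m, A.indicator 1 (x (i.succAbove j)))⁻¹
      ∂(Measure.pi fun _ => μ) ≤ ENNReal.ofReal (2 * exp 400 * (S / w)) := by
    have h1 := lintegral_sum_leaveOneOut_mul_le μ hA ha m
    have h2 : ∫⁻ u, a u ∂μ ≤ ENNReal.ofReal (2 * exp 400 * (S / w)) * μ A := by
      have h3 : ∀ u, a u = ENNReal.ofReal (2 * exp 400) *
          ENNReal.ofReal (‖u - y‖ ^ 2 * exp (-w * ‖u - y‖ ^ 2)) := fun u =>
        ENNReal.ofReal_mul (by positivity)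
      simp only [h3]
      rw [lintegral_const_mul _ (by fun_prop), ENNReal.ofReal_mul (q := S / w) (by positivity),
        mul_assoc]
      exact mul_le_mul_right (lintegral_mul_exp_neg_le hd hw0 hy) _
    exact (ENNReal.mul_le_mul_iff_left hA0 (measure_ne_top _ _)).1 (h1.trans h2)
  refine (lintegral_mono_ae hpt).trans ?_
  have hTm : Measurable (T.indicator fun _ => ENNReal.ofReal 4) := measurable_const.indicator hT
  rw [lintegral_add_left (hTm.const_add _), lintegral_add_left measurable_const, lintegral_const, measure_univ, mul_one,
    ENNReal.ofReal_add (by positivity) (by positivity),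
    ENNReal.ofReal_add (by positivity) (by positivity)]
  gcongr

/-- The expected attention-weighted squared distance when the query is random as well. -/
theorem lintegral_attnW_le {d : ℕ} (hd : d ≠ 0) [IsProbabilityMeasure (sphereUniform d)]
    {w : ℝ} (hw : 25 / 16 ≤ w) {m : ℕ}
    (hn : w ^ ((d : ℝ) / 2) * Real.log (m + 1 : ℕ) ≤ (m + 1 : ℕ)) :
    ∫⁻ x : Fin (m + 1 + 1) → EuclideanSpace ℝ (Fin d), ENNReal.ofReal
        (∑ i, attnW w x i * ‖x i.castSucc - x (Fin.last (m + 1))‖ ^ 2)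
        ∂(Measure.pi fun _ => sphereUniform d) ≤
      ENNReal.ofReal (400 / w + 4 * ((m + 1 : ℕ) : ℝ)⁻¹ + 2 * exp 400 *
        ((∑' k : ℕ, ((k : ℝ) + 1) * exp (-k) * (k + 2) ^ d) / w)) := by
  set f : EuclideanSpace ℝ (Fin d) × (Fin (m + 1) → EuclideanSpace ℝ (Fin d)) → ENNReal :=
    fun p => ENNReal.ofReal (∑ i, exp (-w * ‖p.2 i - p.1‖ ^ 2) /
      (∑ j, exp (-w * ‖p.2 j - p.1‖ ^ 2)) * ‖p.2 i - p.1‖ ^ 2)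
  have hf : Measurable f := by fun_prop
  have h := (measurePreserving_piFinSuccAbove (fun _ : Fin (m + 1 + 1) => sphereUniform d)
    (Fin.last (m + 1))).lintegral_comp hf
  rw [lintegral_prod _ hf.aemeasurable] at h
  have h2 : ∀ x : Fin (m + 1 + 1) → EuclideanSpace ℝ (Fin d), ENNReal.ofReal
        (∑ i, attnW w x i * ‖x i.castSucc - x (Fin.last (m + 1))‖ ^ 2) =
      f (MeasurableEquiv.piFinSuccAbove (fun _ => EuclideanSpace ℝ (Fin d))
        (Fin.last (m + 1)) x) := by
    intro x
    simp [f, attnW, Fin.init]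
  simp only [h2]
  rw [h]
  refine (lintegral_mono_ae (g := fun _ => ENNReal.ofReal (400 / w +
    4 * ((m + 1 : ℕ) : ℝ)⁻¹ + 2 * exp 400 *
      ((∑' k : ℕ, ((k : ℝ) + 1) * exp (-k) * (k + 2) ^ d) / w))) ?_).trans (le_of_eq ?_)
  · filter_upwards [ae_norm_eq_one_sphereUniform d] with y hy
    exact lintegral_gibbs_average_le hd hw hn hy
  · rw [lintegral_const, measure_univ, mul_one]

instance isProbabilityMeasure_unifIcc (L : ℝ) [hL : Fact (0 < L)] :
    IsProbabilityMeasure (unifIcc L) := by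
  constructor
  rw [unifIcc, Measure.smul_apply, Measure.restrict_apply_univ, Real.volume_Icc, smul_eq_mul,
    show L - -L = 2 * L by ring, ENNReal.inv_mul_cancel _ ENNReal.ofReal_ne_top]
  rw [ne_eq, ENNReal.ofReal_eq_zero, not_le]
  linarith [hL.out]

theorem ae_abs_le_unifIcc (L : ℝ) : ∀ᵐ l ∂unifIcc L, |l| ≤ L := by
  refine Measure.ae_smul_measure ?_ _
  filter_upwards [ae_restrict_mem measurableSet_Icc] with x hx
  exact abs_le.2 hx

theorem abs_leakyReLU_sub_le {l₁ l₂ L : ℝ} (h₁ : |l₁| ≤ L) (h₂ : |l₂| ≤ L) (s t : ℝ) :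
    |(l₁ * max s 0 + l₂ * max (-s) 0) - (l₁ * max t 0 + l₂ * max (-t) 0)| ≤ L * |s - t| := by
  have hsplit : |max s 0 - max t 0| + |max (-s) 0 - max (-t) 0| ≤ |s - t| := by
    grind
  calc _ = |l₁ * (max s 0 - max t 0) + l₂ * (max (-s) 0 - max (-t) 0)| := by ring_nf
    _ ≤ |l₁| * |max s 0 - max t 0| + |l₂| * |max (-s) 0 - max (-t) 0| := by
        rw [← abs_mul, ← abs_mul]; exact abs_add_le _ _
    _ ≤ L * |max s 0 - max t 0| + L * |max (-s) 0 - max (-t) 0| := by gcongr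
    _ = L * (|max s 0 - max t 0| + |max (-s) 0 - max (-t) 0|) := by ring
    _ ≤ _ := mul_le_mul_of_nonneg_left hsplit ((abs_nonneg _).trans h₁)

theorem abs_reluF_sub_le {d : ℕ} {L : ℝ} {θ : EuclideanSpace ℝ (Fin d) × ℝ × ℝ × ℝ}
    (hv : ‖θ.1‖ = 1) (h₁ : |θ.2.1| ≤ L) (h₂ : |θ.2.2.1| ≤ L) (x y : EuclideanSpace ℝ (Fin d)) :
    |reluF θ x - reluF θ y| ≤ L * ‖x - y‖ := by
  have h := abs_leakyReLU_sub_le h₁ h₂ (∑ a, θ.1 a * x a) (∑ a, θ.1 a * y a)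
  have h3 : |∑ a, θ.1 a * x a - ∑ a, θ.1 a * y a| ≤ ‖x - y‖ := by
    have := abs_real_inner_le_norm (x - y) θ.1
    rw [hv, mul_one, PiLp.inner_apply] at this
    rw [← Finset.sum_sub_distrib]
    simpa [mul_sub] using this
  have h4 : reluF θ x - reluF θ y =
      (θ.2.1 * max (∑ a, θ.1 a * x a) 0 + θ.2.2.1 * max (-(∑ a, θ.1 a * x a)) 0) -
      (θ.2.1 * max (∑ a, θ.1 a * y a) 0 + θ.2.2.1 * max (-(∑ a, θ.1 a * y a)) 0) := by
    simp only [reluF]; ring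
  rw [h4]
  exact h.trans (mul_le_mul_of_nonneg_left h3 ((abs_nonneg _).trans h₁))

theorem ae_reluTask_lipschitz (d : ℕ) {L : ℝ} (hL : 0 < L)
    [IsProbabilityMeasure (sphereUniform d)] :
    ∀ᵐ θ ∂reluTask d L, ∀ x y, |reluF θ x - reluF θ y| ≤ L * ‖x - y‖ := by
  have : Fact (0 < L) := ⟨hL⟩
  have h₁ : ∀ᵐ θ ∂reluTask d L, ‖θ.1‖ = 1 :=
    Measure.quasiMeasurePreserving_fst.ae (ae_norm_eq_one_sphereUniform d)
  have h₂ : ∀ᵐ θ ∂reluTask d L, |θ.2.1| ≤ L :=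
    (Measure.quasiMeasurePreserving_fst.comp Measure.quasiMeasurePreserving_snd).ae
      (ae_abs_le_unifIcc L)
  have h₃ : ∀ᵐ θ ∂reluTask d L, |θ.2.2.1| ≤ L :=
    (Measure.quasiMeasurePreserving_fst.comp (Measure.quasiMeasurePreserving_snd.comp
      Measure.quasiMeasurePreserving_snd)).ae (ae_abs_le_unifIcc L)
  filter_upwards [h₁, h₂, h₃] with θ h₁ h₂ h₃
  exact abs_reluF_sub_le h₁ h₂ h₃

theorem sum_attnW {d n : ℕ} (hn : 0 < n) (w : ℝ) (x : Fin (n + 1) → EuclideanSpace ℝ (Fin d)) :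
    ∑ i, attnW w x i = 1 := by
  have : Nonempty (Fin n) := ⟨⟨0, hn⟩⟩
  simp only [attnW]
  rw [← Finset.sum_div, div_self]
  exact (Finset.sum_pos (fun i _ => exp_pos _) Finset.univ_nonempty).ne'

theorem attnW_nonneg {d n : ℕ} (w : ℝ) (x : Fin (n + 1) → EuclideanSpace ℝ (Fin d)) (i : Fin n) :
    0 ≤ attnW w x i :=
  div_nonneg (exp_pos _).le (Finset.sum_nonneg fun _ _ => (exp_pos _).le)

theorem sq_attention_error_le {d n : ℕ} (hn : 0 < n) (w : ℝ) {L : ℝ}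
    {f : EuclideanSpace ℝ (Fin d) → ℝ} (hf : ∀ x y, |f x - f y| ≤ L * ‖x - y‖)
    (x : Fin (n + 1) → EuclideanSpace ℝ (Fin d)) :
    (∑ i : Fin n, attnW w x i * (f (x (Fin.last n)) - f (x i.castSucc))) ^ 2 ≤
      L ^ 2 * ∑ i, attnW w x i * ‖x i.castSucc - x (Fin.last n)‖ ^ 2 := by
  refine (Real.pow_arith_mean_le_arith_mean_pow_of_even _ _ _ (fun i _ => attnW_nonneg w x i)
    (sum_attnW hn w x) even_two).trans ?_
  rw [Finset.mul_sum]
  refine Finset.sum_le_sum fun i _ => ?_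
  have h := hf (x (Fin.last n)) (x i.castSucc)
  rw [norm_sub_rev] at h
  have h2 : (f (x (Fin.last n)) - f (x i.castSucc)) ^ 2 ≤
      L ^ 2 * ‖x i.castSucc - x (Fin.last n)‖ ^ 2 := by
    rw [← sq_abs, ← mul_pow]
    gcongr
  calc _ ≤ attnW w x i * (L ^ 2 * ‖x i.castSucc - x (Fin.last n)‖ ^ 2) :=
        mul_le_mul_of_nonneg_left h2 (attnW_nonneg w x i)
    _ = _ := by ring

theorem integral_le_of_lintegral_ofReal_le {α : Type*} [MeasurableSpace α] {μ : Measure α}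
    {f : α → ℝ} (hf : ∀ x, 0 ≤ f x) {M : ℝ} (hM : 0 ≤ M)
    (h : ∫⁻ x, ENNReal.ofReal (f x) ∂μ ≤ ENNReal.ofReal M) : ∫ x, f x ∂μ ≤ M := by
  have h1 := norm_integral_le_lintegral_norm (μ := μ) f
  simp only [Real.norm_of_nonneg (hf _)] at h1
  calc _ ≤ ‖∫ x, f x ∂μ‖ := le_abs_self _
    _ ≤ _ := h1
    _ ≤ (ENNReal.ofReal M).toReal := ENNReal.toReal_mono ENNReal.ofReal_ne_top h
    _ = M := ENNReal.toReal_ofReal hM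

/-- A bound valid for every Lipschitz task function bounds the signal term of ReLU tasks. -/
theorem signalTerm_reluTask_le {d n : ℕ} {w L M : ℝ} (hL : 0 < L)
    [IsProbabilityMeasure (sphereUniform d)]
    (h : ∀ f : EuclideanSpace ℝ (Fin d) → ℝ, (∀ x y, |f x - f y| ≤ L * ‖x - y‖) →
      ∫ x : Fin (n + 1) → EuclideanSpace ℝ (Fin d),
        (∑ i : Fin n, attnW w x i * (f (x (Fin.last n)) - f (x i.castSucc))) ^ 2
        ∂(Measure.pi fun _ => sphereUniform d) ≤ M) :
    signalTerm d n (reluTask d L) reluF w ≤ M := by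
  have : Fact (0 < L) := ⟨hL⟩
  have : IsProbabilityMeasure (reluTask d L) := by unfold reluTask; infer_instance
  rw [signalTerm]
  refine (integral_mono_of_nonneg (g := fun _ => M) ?_ (integrable_const M) ?_).trans
    (by simp)
  · exact Filter.Eventually.of_forall fun θ => integral_nonneg fun x => sq_nonneg _
  · filter_upwards [ae_reluTask_lipschitz d hL] with θ hθ
    exact h _ hθ

theorem signalTerm_reluTask_eq_zero {d n : ℕ} {w L : ℝ} (h : sphereUniform d = 0) :
    signalTerm d n (reluTask d L) reluF w = 0 := by
  rw [signalTerm, reluTask, h, Measure.zero_prod, integral_zero_measure]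

theorem integral_sq_attention_error_le_four {d n : ℕ} (hn : 0 < n) (w : ℝ) {L : ℝ}
    [IsProbabilityMeasure (sphereUniform d)]
    {f : EuclideanSpace ℝ (Fin d) → ℝ} (hf : ∀ x y, |f x - f y| ≤ L * ‖x - y‖) :
    ∫ x : Fin (n + 1) → EuclideanSpace ℝ (Fin d),
      (∑ i : Fin n, attnW w x i * (f (x (Fin.last n)) - f (x i.castSucc))) ^ 2
      ∂(Measure.pi fun _ => sphereUniform d) ≤ 4 * L ^ 2 := by
  refine (integral_mono_of_nonneg (g := fun _ => 4 * L ^ 2) ?_ (integrable_const _) ?_).trans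
    (by simp)
  · exact Filter.Eventually.of_forall fun x => sq_nonneg _
  · have hae : ∀ᵐ x ∂(Measure.pi fun _ : Fin (n + 1) => sphereUniform d), ∀ i, ‖x i‖ = 1 := by
      rw [ae_all_iff]
      intro i
      exact (Measure.tendsto_eval_ae_ae (μ := fun _ : Fin (n + 1) => sphereUniform d)
        (i := i)).eventually (ae_norm_eq_one_sphereUniform d)
    filter_upwards [hae] with x hx
    refine (sq_attention_error_le hn w hf x).trans ?_
    rw [mul_comm 4]
    refine mul_le_mul_of_nonneg_left ?_ (sq_nonneg L)
    calc _ ≤ ∑ i, attnW w x i * 4 := by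
          refine Finset.sum_le_sum fun i _ => mul_le_mul_of_nonneg_left ?_ (attnW_nonneg w x i)
          have := norm_sub_le (x i.castSucc) (x (Fin.last n))
          rw [hx, hx] at this
          nlinarith [norm_nonneg (x i.castSucc - x (Fin.last n))]
      _ = 4 := by rw [← Finset.sum_mul, sum_attnW hn, one_mul]

/-- Lemma 13 (signal term, ReLU tasks, upper bound): (i) the trivial bound `4L²` always
holds, and (ii) in the main regime the signal term is at most `C L² (1/w + 1/n)` for a
constant `C` depending only on `d`. -/
theorem relu_signal_upper_bound (d : ℕ) (hd : 2 ≤ d) :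
    ∃ C : ℝ, 0 < C ∧
      ∀ n : ℕ, 2 ≤ n →
        (∀ w L : ℝ, 0 ≤ w → 0 < L →
          signalTerm d n (reluTask d L) reluF w ≤ 4 * L ^ 2) ∧
        (∀ w L : ℝ, 0 < L → ((d : ℝ) + Real.sqrt d) / 2 ≤ w → 5 < n →
          45 * Real.sqrt d * w ^ ((d : ℝ) / 2) ≤ (n : ℝ) / Real.log n →
          signalTerm d n (reluTask d L) reluF w ≤ C * L ^ 2 * (1 / w + 1 / n)) := by
  have hd0 : d ≠ 0 := by omega
  set S := ∑' k : ℕ, ((k : ℝ) + 1) * exp (-k) * (k + 2) ^ d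
  have hS : 0 ≤ S := tsum_nonneg fun k => by positivity
  refine ⟨400 + 2 * exp 400 * S, by positivity, fun n hn => ?_⟩
  rcases sphereUniform_eq_zero_or_isProbabilityMeasure d with h0 | hprob
  · constructor
    · intro w L _ _
      rw [signalTerm_reluTask_eq_zero h0]
      positivity
    · intro w L _ hw _ _
      have : 0 ≤ w := le_trans (by positivity) hw
      rw [signalTerm_reluTask_eq_zero h0]
      positivity
  constructor
  · intro w L _ hL
    exact signalTerm_reluTask_le hL fun f hf =>
      integral_sq_attention_error_le_four (by omega) w hf
  intro w L hL hw _ hreg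
  have hd2 : (2 : ℝ) ≤ d := by exact_mod_cast hd
  have hsd : 5 / 4 ≤ √(d : ℝ) := le_sqrt_of_sq_le (by linarith)
  have hw' : 25 / 16 ≤ w := by linarith
  have hw0 : 0 < w := by linarith
  have hwd : 0 < w ^ ((d : ℝ) / 2) := rpow_pos_of_pos hw0 _
  have hlog : 0 < Real.log n := log_pos (by exact_mod_cast (by omega : 1 < n))
  have hreg' : w ^ ((d : ℝ) / 2) * Real.log n ≤ n := by
    rw [le_div_iff₀ hlog] at hreg
    refine le_trans ?_ hreg
    gcongr
    nlinarith
  obtain ⟨m, rfl⟩ : ∃ m, n = m + 1 := ⟨n - 1, by omega⟩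
  refine signalTerm_reluTask_le hL fun f hf => ?_
  refine integral_le_of_lintegral_ofReal_le (fun x => sq_nonneg _) (by positivity) ?_
  refine (lintegral_mono fun x =>
    ENNReal.ofReal_le_ofReal (sq_attention_error_le m.succ_pos w hf x)).trans ?_
  simp only [ENNReal.ofReal_mul (sq_nonneg L)]
  rw [lintegral_const_mul' _ _ ENNReal.ofReal_ne_top]
  refine (mul_le_mul_right (lintegral_attnW_le hd0 hw' hreg') _).trans ?_
  rw [← ENNReal.ofReal_mul (sq_nonneg L)]
  refine ENNReal.ofReal_le_ofReal ?_
  rw [mul_comm _ (L ^ 2), mul_assoc (L ^ 2)]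
  refine mul_le_mul_of_nonneg_left ?_ (sq_nonneg L)
  have h1 : 0 ≤ (396 + 2 * exp 400 * S) * ((m + 1 : ℕ) : ℝ)⁻¹ := by positivity
  calc _ ≤ 400 / w + 4 * ((m + 1 : ℕ) : ℝ)⁻¹ + 2 * exp 400 * (S / w) +
        (396 + 2 * exp 400 * S) * ((m + 1 : ℕ) : ℝ)⁻¹ := le_add_of_nonneg_right h1
    _ = _ := by ring
end
end

section
/- (Spherical cap bounds.) Let d ≥ 2, let x ∈ S^{d−1} ⊆ ℝ^d, let x' be uniformly distributed on S^{d−1}, and for ε ∈ (0, 1] let σ_ε := P[ x'^⊤ x > 1 − ε ] be the normalized surface measure of the spherical cap { y ∈ S^{d−1} : y^⊤ x > 1 − ε }. Then (2ε − ε²)^{(d−1)/2} / √(2dπ) ≤ σ_ε ≤ (2ε − ε²)^{(d−1)/2} / 2. -/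
open MeasureTheory Real
open scoped RealInnerProductSpace

noncomputable section

open Set Metric Topology
open scoped ENNReal

/-- The part of the solid cone `{p | t ‖p‖ < p.1}` lying in the open unit ball of `ℝ × F`. -/
def solidCone (F : Type*) [NormedAddCommGroup F] (t : ℝ) : Set (ℝ × F) :=
  {p | t * √(p.1 ^ 2 + ‖p.2‖ ^ 2) < p.1 ∧ p.1 ^ 2 + ‖p.2‖ ^ 2 < 1}

/-- The solid of revolution in `ℝ × F` with radius profile `f` over `(0, 1)`. -/
def revolutionSolid (F : Type*) [NormedAddCommGroup F] (f : ℝ → ℝ) : Set (ℝ × F) :=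
  {p | (0 < p.1 ∧ p.1 < 1) ∧ ‖p.2‖ < f p.1}

section Volume

variable {F : Type*} [NormedAddCommGroup F]

lemma measurableSet_solidCone [MeasurableSpace F] [OpensMeasurableSpace F] (t : ℝ) :
    MeasurableSet (solidCone F t) := by
  rw [solidCone, ofPred_and]
  exact (measurableSet_lt (by fun_prop) (by fun_prop)).inter
    (measurableSet_lt (by fun_prop) (by fun_prop))

lemma measurableSet_revolutionSolid [MeasurableSpace F] [OpensMeasurableSpace F]
    {f : ℝ → ℝ} (hf : Measurable f) :
    MeasurableSet (revolutionSolid F f) := by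
  rw [revolutionSolid, ofPred_and, ofPred_and]
  exact ((measurableSet_lt (by fun_prop) (by fun_prop)).inter
    (measurableSet_lt (by fun_prop) (by fun_prop))).inter
    (measurableSet_lt (by fun_prop) (by fun_prop))

lemma solidCone_slice {a t : ℝ} (ha : 0 < a) (ht : 0 ≤ t) (hat : a ^ 2 + t ^ 2 = 1) (z : F) :
    (fun s : ℝ ↦ (s, z)) ⁻¹' solidCone F t = Ioo (t * ‖z‖ / a) √(1 - ‖z‖ ^ 2) := by
  have hz := norm_nonneg z
  ext s
  simp only [solidCone, mem_preimage, mem_ofPred_eq, mem_Ioo]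
  rw [div_lt_iff₀ ha]
  constructor
  · rintro ⟨h1, h2⟩
    have hs : 0 < s := lt_of_le_of_lt (by positivity) h1
    refine ⟨?_, lt_sqrt_of_sq_lt (by linarith)⟩
    have h3 : (t * √(s ^ 2 + ‖z‖ ^ 2)) ^ 2 < s ^ 2 := by gcongr
    rw [mul_pow, sq_sqrt (by positivity)] at h3
    exact lt_of_pow_lt_pow_left₀ 2 (by positivity) (by nlinarith)
  · rintro ⟨h1, h2⟩
    have hs : 0 < s := pos_of_mul_pos_left (lt_of_le_of_lt (by positivity) h1) ha.le
    have h4 := (lt_sqrt hs.le).1 h2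
    refine ⟨?_, by linarith⟩
    have h3 : (t * ‖z‖) ^ 2 < (s * a) ^ 2 := by gcongr
    refine lt_of_pow_lt_pow_left₀ 2 hs.le ?_
    rw [mul_pow, sq_sqrt (by positivity)]
    nlinarith

lemma revolutionSolid_slice_sqrt {a : ℝ} (ha : 0 < a) (z : F) :
    (fun s : ℝ ↦ (s, z)) ⁻¹' revolutionSolid F (fun s ↦ a * √(1 - s ^ 2)) =
      Ioo 0 √(1 - (‖z‖ / a) ^ 2) := by
  have hz := norm_nonneg z
  ext s
  simp only [revolutionSolid, mem_preimage, mem_ofPred_eq, mem_Ioo]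
  rw [← div_lt_iff₀' ha, lt_sqrt (by positivity)]
  constructor
  · rintro ⟨⟨h1, h2⟩, h3⟩
    exact ⟨h1, lt_sqrt_of_sq_lt (by linarith)⟩
  · rintro ⟨h1, h2⟩
    have h4 := (lt_sqrt h1.le).1 h2
    exact ⟨⟨h1, by nlinarith [sq_nonneg (‖z‖ / a)]⟩, by linarith⟩

lemma revolutionSolid_slice_linear {a : ℝ} (ha : 0 < a) (z : F) :
    (fun s : ℝ ↦ (s, z)) ⁻¹' revolutionSolid F (fun s ↦ a * (1 - s)) =
      Ioo 0 (1 - ‖z‖ / a) := by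
  have hz : 0 ≤ ‖z‖ / a := by positivity
  ext s
  simp only [revolutionSolid, mem_preimage, mem_ofPred_eq, mem_Ioo]
  rw [← div_lt_iff₀' ha]
  constructor
  · rintro ⟨⟨h1, h2⟩, h3⟩
    exact ⟨h1, by linarith⟩
  · rintro ⟨h1, h2⟩
    exact ⟨⟨h1, by linarith⟩, by linarith⟩

variable [InnerProductSpace ℝ F] [FiniteDimensional ℝ F] [MeasurableSpace F] [BorelSpace F]

lemma volume_revolutionSolid {f : ℝ → ℝ} (hf : Measurable f) :
    volume (revolutionSolid F f) = ∫⁻ s in Ioo (0 : ℝ) 1, volume (ball (0 : F) (f s)) := by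
  rw [Measure.volume_eq_prod, Measure.prod_apply (measurableSet_revolutionSolid hf),
    ← lintegral_indicator measurableSet_Ioo]
  refine lintegral_congr fun s ↦ ?_
  by_cases hs : s ∈ Ioo (0 : ℝ) 1
  · rw [indicator_of_mem hs]
    congr 1
    ext z
    simp [revolutionSolid, hs.1, hs.2]
  · have h : Prod.mk s ⁻¹' revolutionSolid F f = ∅ :=
      eq_empty_of_forall_notMem fun z hz ↦ hs hz.1
    rw [indicator_of_notMem hs, h, measure_empty]

lemma volume_revolutionSolid_mul {f : ℝ → ℝ} (hf : Measurable f) {a : ℝ} (ha : 0 < a) :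
    volume (revolutionSolid F (fun s ↦ a * f s)) =
      ENNReal.ofReal (a ^ Module.finrank ℝ F) * volume (revolutionSolid F f) := by
  rw [volume_revolutionSolid hf, volume_revolutionSolid (hf.const_mul a),
    ← lintegral_const_mul' _ _ ENNReal.ofReal_ne_top]
  refine lintegral_congr fun s ↦ ?_
  rw [Measure.addHaar_ball_mul_of_pos _ _ ha]

lemma volume_revolutionSolid_one_sub :
    volume (revolutionSolid F (fun s ↦ 1 - s)) =
      ENNReal.ofReal (1 / ((Module.finrank ℝ F : ℝ) + 1)) * volume (ball (0 : F) 1) := by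
  set n := Module.finrank ℝ F
  have h0 : ∀ s ∈ Ioo (0 : ℝ) 1, volume (ball (0 : F) (1 - s)) =
      ENNReal.ofReal ((1 - s) ^ n) * volume (ball (0 : F) 1) := by
    intro s hs
    exact Measure.addHaar_ball_of_pos _ _ (by linarith [hs.2])
  have hint : ∫ s in (0 : ℝ)..1, (1 - s) ^ n = 1 / ((n : ℝ) + 1) := by
    rw [intervalIntegral.integral_comp_sub_left (fun s : ℝ ↦ s ^ n) 1]
    simp
  rw [volume_revolutionSolid (by fun_prop), setLIntegral_congr_fun measurableSet_Ioo h0,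
    lintegral_mul_const' _ _ measure_ball_lt_top.ne, ← ofReal_integral_eq_lintegral_ofReal,
    ← integral_Ioc_eq_integral_Ioo, ← intervalIntegral.integral_of_le zero_le_one, hint]
  · exact ((by fun_prop : Continuous fun s : ℝ ↦ (1 - s) ^ n).integrableOn_Icc).mono_set
      Ioo_subset_Icc_self
  · filter_upwards [ae_restrict_mem measurableSet_Ioo] with s hs
    have : 0 ≤ 1 - s := by linarith [hs.2]
    positivity

lemma volume_unitBall_prod :
    volume {p : ℝ × F | p.1 ^ 2 + ‖p.2‖ ^ 2 < 1} =
      2 * volume (revolutionSolid F (fun s ↦ √(1 - s ^ 2))) := by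
  have h : MeasurableSet {p : ℝ × F | p.1 ^ 2 + ‖p.2‖ ^ 2 < 1} :=
    measurableSet_lt (by fun_prop) (by fun_prop)
  have hm : Measurable (fun s : ℝ ↦ √(1 - s ^ 2)) := by fun_prop
  rw [Measure.volume_eq_prod, Measure.prod_apply_symm h,
    Measure.prod_apply_symm (measurableSet_revolutionSolid hm),
    ← lintegral_const_mul' _ _ ENNReal.ofNat_ne_top]
  refine lintegral_congr fun z ↦ ?_
  have h1 := revolutionSolid_slice_sqrt one_pos z
  simp only [one_mul, div_one] at h1
  have h2 : (fun s : ℝ ↦ (s, z)) ⁻¹' {p : ℝ × F | p.1 ^ 2 + ‖p.2‖ ^ 2 < 1} =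
      Ioo (-√(1 - ‖z‖ ^ 2)) √(1 - ‖z‖ ^ 2) := by
    ext s
    simp only [mem_preimage, mem_ofPred_eq, mem_Ioo]
    rw [← abs_lt, lt_sqrt (abs_nonneg s), sq_abs]
    constructor <;> intro h <;> linarith
  rw [h1, h2, Real.volume_Ioo, Real.volume_Ioo, sub_neg_eq_add, sub_zero, ← two_mul,
    ENNReal.ofReal_mul zero_le_two, ENNReal.ofReal_ofNat]

lemma volume_solidCone_le {a t : ℝ} (ha : 0 < a) (ht : 0 ≤ t) (hat : a ^ 2 + t ^ 2 = 1) :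
    volume (solidCone F t) ≤ volume (revolutionSolid F (fun s ↦ a * √(1 - s ^ 2))) := by
  rw [Measure.volume_eq_prod, Measure.prod_apply_symm (measurableSet_solidCone t),
    Measure.prod_apply_symm (measurableSet_revolutionSolid (by fun_prop))]
  refine lintegral_mono fun z ↦ ?_
  rw [solidCone_slice ha ht hat, revolutionSolid_slice_sqrt ha, Real.volume_Ioo, Real.volume_Ioo,
    sub_zero]
  refine ENNReal.ofReal_le_ofReal ?_
  obtain ⟨r, hr⟩ : ∃ r, r = ‖z‖ / a := ⟨_, rfl⟩
  have hr0 : 0 ≤ r := hr ▸ by positivity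
  have hz : ‖z‖ = a * r := by rw [hr]; field_simp
  rw [← hr, mul_div_assoc, ← hr, hz, sub_le_iff_le_add]
  refine sqrt_le_iff.2 ⟨by positivity, ?_⟩
  rcases le_total (r ^ 2) 1 with h | h
  · nlinarith [sq_sqrt (sub_nonneg.2 h), mul_nonneg (sqrt_nonneg (1 - r ^ 2)) (mul_nonneg ht hr0)]
  · rw [sqrt_eq_zero_of_nonpos (by linarith)]
    nlinarith

lemma le_volume_solidCone {a t : ℝ} (ha : 0 < a) (ht : 0 ≤ t) (hat : a ^ 2 + t ^ 2 = 1) :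
    volume (revolutionSolid F (fun s ↦ a * (1 - s))) ≤ volume (solidCone F t) := by
  rw [Measure.volume_eq_prod, Measure.prod_apply_symm (measurableSet_solidCone t),
    Measure.prod_apply_symm (measurableSet_revolutionSolid (by fun_prop))]
  refine lintegral_mono fun z ↦ ?_
  rw [solidCone_slice ha ht hat, revolutionSolid_slice_linear ha, Real.volume_Ioo, Real.volume_Ioo,
    sub_zero]
  obtain ⟨r, hr⟩ : ∃ r, r = ‖z‖ / a := ⟨_, rfl⟩
  have hr0 : 0 ≤ r := hr ▸ by positivity
  have hz : ‖z‖ = a * r := by rw [hr]; field_simp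
  rw [← hr, mul_div_assoc, ← hr, hz]
  rcases le_total r 1 with h | h
  · refine ENNReal.ofReal_le_ofReal ?_
    rw [le_sub_iff_add_le]
    refine le_sqrt_of_sq_le ?_
    have ht1 : t ≤ 1 := by nlinarith
    have har : (a * r) ^ 2 = (1 - t ^ 2) * r ^ 2 := by rw [mul_pow, ← hat]; ring
    nlinarith [mul_nonneg (mul_nonneg hr0 (sub_nonneg.2 h)) (sub_nonneg.2 ht1)]
  · rw [ENNReal.ofReal_of_nonpos (by linarith)]
    exact zero_le

end Volume

lemma Gamma_add_half_le_sqrt_mul {u : ℝ} (hu : 0 < u) : Gamma (u + 1 / 2) ≤ √u * Gamma u := by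
  have h := Gamma_mul_add_mul_le_rpow_Gamma_mul_rpow_Gamma hu (by linarith : 0 < u + 1)
    one_half_pos one_half_pos (by norm_num)
  have hg := Gamma_pos_of_pos hu
  rw [Gamma_add_one hu.ne', ← mul_rpow hg.le (by positivity), ← sqrt_eq_rpow,
    show Gamma u * (u * Gamma u) = u * Gamma u ^ 2 by ring, sqrt_mul hu.le,
    sqrt_sq hg.le] at h
  convert h using 2
  ring

lemma volume_unitBall_succ_le (n : ℕ) [NeZero n] :
    (n + 1 : ℝ) * volume.real (ball (0 : EuclideanSpace ℝ (Fin (n + 1))) 1) ≤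
      √(2 * (n + 1) * π) * volume.real (ball (0 : EuclideanSpace ℝ (Fin n)) 1) := by
  have hg1 : 0 < Gamma ((n : ℝ) / 2 + 1) := Gamma_pos_of_pos (by positivity)
  have hg2 : 0 < Gamma (((n : ℝ) + 1) / 2) := Gamma_pos_of_pos (by positivity)
  have hG := Gamma_add_half_le_sqrt_mul (by positivity : 0 < ((n : ℝ) + 1) / 2)
  rw [show ((n : ℝ) + 1) / 2 + 1 / 2 = n / 2 + 1 by ring] at hG
  have hs : √(2 * (n + 1) * π) = 2 * √(((n : ℝ) + 1) / 2) * √π := by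
    rw [show 2 * ((n : ℝ) + 1) * π = 2 ^ 2 * (((n : ℝ) + 1) / 2) * π by ring,
      sqrt_mul (by positivity), sqrt_mul (by positivity), sqrt_sq zero_le_two]
  have hg3 : Gamma (((n : ℝ) + 1) / 2 + 1) = ((n : ℝ) + 1) / 2 * Gamma (((n : ℝ) + 1) / 2) :=
    Gamma_add_one (by positivity)
  simp only [Measure.real, EuclideanSpace.volume_ball, Fintype.card_fin, ENNReal.ofReal_one,
    one_pow, one_mul, Nat.cast_add, Nat.cast_one]
  rw [ENNReal.toReal_ofReal (by rw [hg3]; positivity), ENNReal.toReal_ofReal (by positivity),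
    hs, hg3, pow_succ]
  calc _ = 2 * √π ^ n * √π / Gamma (((n : ℝ) + 1) / 2) := by field_simp
    _ ≤ _ := by
      rw [div_le_iff₀ hg2]
      calc _ = 2 * √π ^ n * √π / Gamma ((n : ℝ) / 2 + 1) * Gamma ((n : ℝ) / 2 + 1) := by
            field_simp
        _ ≤ 2 * √π ^ n * √π / Gamma ((n : ℝ) / 2 + 1) *
            (√(((n : ℝ) + 1) / 2) * Gamma (((n : ℝ) + 1) / 2)) := by gcongr
        _ = _ := by ring

section Sphere

variable {n : ℕ}

lemma exists_linearIsometryEquiv_prod (x : EuclideanSpace ℝ (Fin (n + 1))) (hx : ‖x‖ = 1) :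
    ∃ L : EuclideanSpace ℝ (Fin (n + 1)) ≃ₗᵢ[ℝ] WithLp 2 (ℝ × EuclideanSpace ℝ (Fin n)),
      L x = WithLp.toLp 2 (1, 0) := by
  have hfin : Module.finrank ℝ (WithLp 2 (ℝ × EuclideanSpace ℝ (Fin n))) = n + 1 := by
    rw [(WithLp.linearEquiv 2 ℝ (ℝ × EuclideanSpace ℝ (Fin n))).finrank_eq]
    simp [add_comm]
  let L := ((stdOrthonormalBasis ℝ (WithLp 2 (ℝ × EuclideanSpace ℝ (Fin n)))).reindex
    (finCongr hfin)).repr.symm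
  refine ⟨L.trans (Submodule.reflection (ℝ ∙ (L x - WithLp.toLp 2 (1, 0)))ᗮ), ?_⟩
  refine Submodule.reflection_sub ?_
  rw [L.norm_map, hx, ← sq_eq_sq₀ zero_le_one (norm_nonneg _), WithLp.prod_norm_sq_eq_of_L2]
  simp

lemma volume_cone_inter_ball {x : EuclideanSpace ℝ (Fin (n + 1))} (hx : ‖x‖ = 1) (t : ℝ) :
    volume ({y : EuclideanSpace ℝ (Fin (n + 1)) | t * ‖y‖ < ⟪y, x⟫} ∩ ball 0 1) =
      volume (solidCone (EuclideanSpace ℝ (Fin n)) t) := by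
  obtain ⟨L, hL⟩ := exists_linearIsometryEquiv_prod x hx
  rw [← ((WithLp.volume_preserving_ofLp ℝ (EuclideanSpace ℝ (Fin n))).comp
    L.measurePreserving).measure_preimage (measurableSet_solidCone t).nullMeasurableSet]
  congr 1
  ext y
  have h1 : ‖y‖ ^ 2 = (L y).fst ^ 2 + ‖(L y).snd‖ ^ 2 := by
    rw [← L.norm_map, WithLp.prod_norm_sq_eq_of_L2, norm_eq_abs, sq_abs]
  have h2 : ⟪y, x⟫ = (L y).fst := by
    rw [← L.inner_map_map, hL, WithLp.prod_inner_apply]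
    simp
  have h3 : √((L y).fst ^ 2 + ‖(L y).snd‖ ^ 2) = ‖y‖ := by rw [← h1, sqrt_sq (norm_nonneg _)]
  have h4 : ‖y‖ < 1 ↔ (L y).fst ^ 2 + ‖(L y).snd‖ ^ 2 < 1 := by
    rw [← h1, sq_lt_one_iff₀ (norm_nonneg _)]
  simp only [mem_inter_iff, mem_ofPred_eq, mem_ball_zero_iff, h2, h4, solidCone, mem_preimage,
    Function.comp_apply]
  rw [← h3]
  rfl

lemma volume_unitBall_euclideanSpace_succ :
    volume (ball (0 : EuclideanSpace ℝ (Fin (n + 1))) 1) =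
      2 * volume (revolutionSolid (EuclideanSpace ℝ (Fin n)) (fun s ↦ √(1 - s ^ 2))) := by
  obtain ⟨L, -⟩ := exists_linearIsometryEquiv_prod (EuclideanSpace.single (0 : Fin (n + 1)) 1)
    (by simp)
  have hm : MeasurableSet {p : ℝ × EuclideanSpace ℝ (Fin n) | p.1 ^ 2 + ‖p.2‖ ^ 2 < 1} :=
    measurableSet_lt (by fun_prop) (by fun_prop)
  rw [← volume_unitBall_prod, ← ((WithLp.volume_preserving_ofLp ℝ (EuclideanSpace ℝ (Fin n))).comp
    L.measurePreserving).measure_preimage hm.nullMeasurableSet]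
  congr 1
  ext y
  rw [mem_ball_zero_iff, ← sq_lt_one_iff₀ (norm_nonneg _), ← L.norm_map,
    WithLp.prod_norm_sq_eq_of_L2, norm_eq_abs, sq_abs]
  rfl

lemma hausdorffMeasure_sphere_pos :
    0 < μH[(n : ℝ)] (sphere (0 : EuclideanSpace ℝ (Fin (n + 1))) 1) := by
  obtain ⟨L, -⟩ := exists_linearIsometryEquiv_prod (EuclideanSpace.single (0 : Fin (n + 1)) 1)
    (by simp)
  let P : EuclideanSpace ℝ (Fin (n + 1)) → Fin n → ℝ := fun y ↦ (L y).snd.ofLp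
  have hP : LipschitzWith (1 * (1 * 1)) P := by
    have hsnd : LipschitzWith 1
        (WithLp.snd : WithLp 2 (ℝ × EuclideanSpace ℝ (Fin n)) → EuclideanSpace ℝ (Fin n)) := by
      have h := LipschitzWith.prod_snd.comp
        (WithLp.prod_lipschitzWith_ofLp 2 ℝ (EuclideanSpace ℝ (Fin n)))
      rwa [mul_one] at h
    exact (PiLp.lipschitzWith_ofLp 2 _).comp (hsnd.comp L.lipschitz)
  have hopen : IsOpen ((WithLp.toLp 2 : (Fin n → ℝ) → EuclideanSpace ℝ (Fin n)) ⁻¹' ball 0 1) :=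
    isOpen_ball.preimage (PiLp.continuous_toLp 2 _)
  have hpos : 0 < (volume : Measure (Fin n → ℝ))
      ((WithLp.toLp 2 : (Fin n → ℝ) → EuclideanSpace ℝ (Fin n)) ⁻¹' ball 0 1) :=
    hopen.measure_pos _ ⟨0, by simp⟩
  have hle := hP.hausdorffMeasure_image_le (Nat.cast_nonneg n)
    (sphere (0 : EuclideanSpace ℝ (Fin (n + 1))) 1)
  simp only [mul_one, ENNReal.coe_one, ENNReal.one_rpow, one_mul] at hle
  have hv : (μH[(n : ℝ)] : Measure (Fin n → ℝ)) = volume := by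
    simpa using hausdorffMeasure_pi_real (ι := Fin n)
  rw [hv] at hle
  refine hpos.trans_le ((measure_mono ?_).trans hle)
  intro z hz
  have hz1 : ‖(WithLp.toLp 2 z : EuclideanSpace ℝ (Fin n))‖ ^ 2 ≤ 1 := by
    have := mem_ball_zero_iff.1 hz
    nlinarith [norm_nonneg (WithLp.toLp 2 z : EuclideanSpace ℝ (Fin n))]
  refine ⟨L.symm (WithLp.toLp 2 (√(1 - ‖(WithLp.toLp 2 z : EuclideanSpace ℝ (Fin n))‖ ^ 2),
    WithLp.toLp 2 z)), ?_, by simp [P]⟩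
  rw [mem_sphere_zero_iff_norm, L.symm.norm_map, ← sq_eq_sq₀ (norm_nonneg _) zero_le_one,
    WithLp.prod_norm_sq_eq_of_L2, norm_eq_abs, sq_abs, WithLp.toLp_fst, WithLp.toLp_snd,
    sq_sqrt (by linarith)]
  simp

lemma hausdorffMeasure_sphere_lt_top :
    μH[(n : ℝ)] (sphere (0 : EuclideanSpace ℝ (Fin (n + 1))) 1) < ∞ := by
  refine (isCompact_sphere _ _).measure_lt_top_of_nhdsWithin fun x hx ↦ ?_
  rw [mem_sphere_zero_iff_norm] at hx
  obtain ⟨L, hL⟩ := exists_linearIsometryEquiv_prod x hx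
  let V : (Fin n → ℝ) → EuclideanSpace ℝ (Fin (n + 1)) := fun z ↦
    L.symm (WithLp.toLp 2 (1, WithLp.toLp 2 z))
  let G : (Fin n → ℝ) → EuclideanSpace ℝ (Fin (n + 1)) := fun z ↦ ‖V z‖⁻¹ • V z
  have hV0 : V 0 = x := by simp [V, ← hL]
  have hV : ContDiff ℝ 1 V := by
    refine L.symm.contDiff.comp ?_
    exact (WithLp.prodContinuousLinearEquiv 2 ℝ ℝ (EuclideanSpace ℝ (Fin n))).symm.contDiff.comp
      (contDiff_const.prodMk PiLp.contDiff_toLp)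
  have hx0 : V 0 ≠ 0 := by
    rw [hV0, ← norm_ne_zero_iff, hx]
    exact one_ne_zero
  have hG : ContDiffAt ℝ 1 G 0 :=
    ((hV.contDiffAt.norm ℝ hx0).inv (norm_ne_zero_iff.2 hx0)).smul hV.contDiffAt
  obtain ⟨K, T, hT, hK⟩ := hG.exists_lipschitzOnWith
  have hv : (μH[(n : ℝ)] : Measure (Fin n → ℝ)) = volume := by
    simpa using hausdorffMeasure_pi_real (ι := Fin n)
  have hfin : μH[(n : ℝ)] (G '' (T ∩ ball 0 1)) < ∞ := by
    refine ((hK.mono inter_subset_left).hausdorffMeasure_image_le (Nat.cast_nonneg n)).trans_lt ?_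
    rw [hv]
    exact ENNReal.mul_lt_top (ENNReal.rpow_lt_top_of_nonneg (Nat.cast_nonneg n) ENNReal.coe_ne_top)
      ((measure_mono inter_subset_right).trans_lt measure_ball_lt_top)
  let Z : EuclideanSpace ℝ (Fin (n + 1)) → Fin n → ℝ := fun y ↦ ((L y).fst⁻¹ • (L y).snd).ofLp
  have hcont : ContinuousAt (fun y ↦ (L y).fst) x := by fun_prop
  have hfst : (L x).fst = 1 := by simp [hL]
  have hZ0 : Z x = 0 := by simp [Z, hL]
  have hZ : ContinuousAt Z x := by
    refine (PiLp.continuous_ofLp 2 _).continuousAt.comp ?_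
    exact (hcont.inv₀ (by simp [hfst])).smul (by fun_prop)
  have hmem : Z ⁻¹' (T ∩ ball 0 1) ∩ {y | 0 < (L y).fst} ∈ 𝓝 x := by
    refine Filter.inter_mem (hZ ?_) (hcont.eventually (lt_mem_nhds (by simp [hfst])))
    rw [hZ0]
    exact Filter.inter_mem hT (ball_mem_nhds _ one_pos)
  refine ⟨_, inter_mem_nhdsWithin _ hmem, (measure_mono ?_).trans_lt hfin⟩
  rintro y ⟨hy, hyT, hy0⟩
  refine ⟨Z y, hyT, ?_⟩
  rw [mem_sphere_zero_iff_norm] at hy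
  have hVZ : V (Z y) = (L y).fst⁻¹ • y := by
    apply L.injective
    rw [L.apply_symm_apply, map_smul]
    refine (WithLp.ofLp_injective 2) (Prod.ext ?_ ?_)
    · exact (inv_mul_cancel₀ (ne_of_gt hy0)).symm
    · rfl
  have hy0' : 0 < (L y).fst := hy0
  simp only [G, hVZ, norm_smul, norm_inv, norm_eq_abs, abs_of_pos hy0', hy, mul_one, inv_inv]
  rw [smul_smul, mul_inv_cancel₀ hy0'.ne', one_smul]

lemma hausdorffMeasure_sphere_inter_eq {x y : EuclideanSpace ℝ (Fin (n + 1))} (hx : ‖x‖ = 1)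
    (hy : y ≠ 0) (t : ℝ) :
    μH[(n : ℝ)] ({z | t * ‖y‖ < ⟪y, z⟫} ∩ sphere 0 1) =
      μH[(n : ℝ)] ({z | t < ⟪z, x⟫} ∩ sphere 0 1) := by
  have hy' : 0 < ‖y‖ := norm_pos_iff.2 hy
  let u := ‖y‖⁻¹ • y
  have hu : ‖u‖ = ‖x‖ := by
    rw [hx, norm_smul, norm_inv, norm_norm, inv_mul_cancel₀ hy'.ne']
  let R := Submodule.reflection (ℝ ∙ (u - x))ᗮ
  have hR : R u = x := Submodule.reflection_sub hu
  rw [← R.toIsometryEquiv.hausdorffMeasure_preimage (n : ℝ) ({z | t < ⟪z, x⟫} ∩ sphere 0 1)]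
  congr 1
  ext z
  have h1 : ⟪R z, x⟫ = ‖y‖⁻¹ * ⟪y, z⟫ := by
    rw [← hR, R.inner_map_map, real_inner_comm, real_inner_smul_left]
  simp only [mem_inter_iff, mem_preimage, mem_ofPred_eq, mem_sphere_zero_iff_norm,
    LinearIsometryEquiv.coe_toIsometryEquiv, R.norm_map, h1]
  rw [← div_eq_inv_mul, lt_div_iff₀ hy']

lemma hausdorffMeasure_cap_mul_volume_ball {x : EuclideanSpace ℝ (Fin (n + 1))} (hx : ‖x‖ = 1)
    (t : ℝ) :
    μH[(n : ℝ)] ({z | t < ⟪z, x⟫} ∩ sphere 0 1) *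
        volume (ball (0 : EuclideanSpace ℝ (Fin (n + 1))) 1) =
      volume (solidCone (EuclideanSpace ℝ (Fin n)) t) *
        μH[(n : ℝ)] (sphere (0 : EuclideanSpace ℝ (Fin (n + 1))) 1) := by
  let E := EuclideanSpace ℝ (Fin (n + 1))
  let μ : Measure E := μH[(n : ℝ)].restrict (sphere 0 1)
  let ν : Measure E := volume.restrict (ball 0 1)
  have : IsFiniteMeasure μ :=
    ⟨by rw [Measure.restrict_apply_univ]; exact hausdorffMeasure_sphere_lt_top⟩
  let A : Set (E × E) := {p | t * ‖p.2‖ < ⟪p.2, p.1⟫}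
  have hA : MeasurableSet A := measurableSet_lt (by fun_prop) (by fun_prop)
  have h1 : (μ.prod ν) A = volume (solidCone (EuclideanSpace ℝ (Fin n)) t) *
      μH[(n : ℝ)] (sphere (0 : E) 1) := by
    rw [Measure.prod_apply hA, ← setLIntegral_const]
    refine setLIntegral_congr_fun isClosed_sphere.measurableSet fun z hz ↦ ?_
    rw [← volume_cone_inter_ball (mem_sphere_zero_iff_norm.1 hz) t]
    exact Measure.restrict_apply' measurableSet_ball
  have h2 : (μ.prod ν) A = μH[(n : ℝ)] ({z | t < ⟪z, x⟫} ∩ sphere 0 1) *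
      volume (ball (0 : E) 1) := by
    rw [Measure.prod_apply_symm hA, ← setLIntegral_const]
    refine lintegral_congr_ae ?_
    filter_upwards [ae_restrict_of_ae (Measure.ae_ne volume (0 : E))] with y hy
    rw [← hausdorffMeasure_sphere_inter_eq hx hy t]
    exact Measure.restrict_apply' isClosed_sphere.measurableSet
  rw [← h1, ← h2]

lemma sphereUniform_cap {x : EuclideanSpace ℝ (Fin (n + 1))} (hx : ‖x‖ = 1) (t : ℝ) :
    sphereUniform (n + 1) {y | t < ⟪y, x⟫} =
      volume (solidCone (EuclideanSpace ℝ (Fin n)) t) /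
        volume (ball (0 : EuclideanSpace ℝ (Fin (n + 1))) 1) := by
  have h := hausdorffMeasure_cap_mul_volume_ball hx t
  have hd : ((n + 1 : ℕ) : ℝ) - 1 = n := by push_cast; ring
  rw [sphereUniform, hd, Measure.smul_apply, smul_eq_mul,
    Measure.restrict_apply' isClosed_sphere.measurableSet, mul_comm, ← div_eq_mul_inv,
    ENNReal.eq_div_iff (measure_ball_pos _ _ one_pos).ne' measure_ball_lt_top.ne,
    ← mul_div_assoc, mul_comm, h,
    ENNReal.mul_div_cancel_right hausdorffMeasure_sphere_pos.ne' hausdorffMeasure_sphere_lt_top.ne]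

end Sphere

/-- Lemma 17 (spherical cap bounds): for `x ∈ S^{d-1}` and `ε ∈ (0, 1]`, the normalized
surface measure `σ_ε` of the spherical cap `{ y : yᵀx > 1 − ε }` satisfies
`(2ε − ε²)^{(d−1)/2}/√(2dπ) ≤ σ_ε ≤ (2ε − ε²)^{(d−1)/2}/2`. -/
theorem spherical_cap_bounds (d : ℕ) (hd : 2 ≤ d)
    (x : EuclideanSpace ℝ (Fin d)) (hx : ‖x‖ = 1)
    (ε : ℝ) (hε0 : 0 < ε) (hε1 : ε ≤ 1) :
    (2 * ε - ε ^ 2) ^ (((d : ℝ) - 1) / 2) / Real.sqrt (2 * d * π) ≤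
        ((sphereUniform d) {y : EuclideanSpace ℝ (Fin d) | 1 - ε < ⟪y, x⟫}).toReal ∧
      ((sphereUniform d) {y : EuclideanSpace ℝ (Fin d) | 1 - ε < ⟪y, x⟫}).toReal ≤
        (2 * ε - ε ^ 2) ^ (((d : ℝ) - 1) / 2) / 2 := by
  obtain ⟨n, rfl⟩ : ∃ n, d = n + 1 := ⟨d - 1, by omega⟩
  have : NeZero n := ⟨by omega⟩
  have hpos : 0 < 2 * ε - ε ^ 2 := by nlinarith
  obtain ⟨a, ha⟩ : ∃ a, a = √(2 * ε - ε ^ 2) := ⟨_, rfl⟩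
  have ha0 : 0 < a := ha ▸ sqrt_pos.2 hpos
  have ha2 : a ^ 2 = 2 * ε - ε ^ 2 := by rw [ha, sq_sqrt hpos.le]
  have hat : a ^ 2 + (1 - ε) ^ 2 = 1 := by rw [ha2]; ring
  have ht : 0 ≤ 1 - ε := by linarith
  have hpow : (2 * ε - ε ^ 2) ^ ((((n + 1 : ℕ) : ℝ) - 1) / 2) = a ^ n := by
    rw [← ha2, ← rpow_natCast a 2, ← rpow_mul ha0.le, ← rpow_natCast a n]
    congr 1
    push_cast
    ring
  have hup := volume_solidCone_le (F := EuclideanSpace ℝ (Fin n)) ha0 ht hat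
  have hlow := le_volume_solidCone (F := EuclideanSpace ℝ (Fin n)) ha0 ht hat
  rw [volume_revolutionSolid_mul (by fun_prop) ha0, finrank_euclideanSpace_fin] at hup hlow
  rw [volume_revolutionSolid_one_sub, finrank_euclideanSpace_fin] at hlow
  have hball := volume_unitBall_euclideanSpace_succ (n := n)
  have hsucc := volume_unitBall_succ_le n
  have hBtop : volume (ball (0 : EuclideanSpace ℝ (Fin (n + 1))) 1) ≠ ∞ := measure_ball_lt_top.ne
  have hB : 0 < volume.real (ball (0 : EuclideanSpace ℝ (Fin (n + 1))) 1) :=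
    ENNReal.toReal_pos (measure_ball_pos _ _ one_pos).ne' hBtop
  have hrtop : volume (revolutionSolid (EuclideanSpace ℝ (Fin n)) (fun s ↦ √(1 - s ^ 2))) ≠ ∞ := by
    intro h
    rw [h] at hball
    exact hBtop (by simp [hball])
  have hutop := ENNReal.mul_ne_top (ENNReal.ofReal_ne_top (r := a ^ n)) hrtop
  have hup' := ENNReal.toReal_mono hutop hup
  have hlow' := ENNReal.toReal_mono (ne_top_of_le_ne_top hutop hup) hlow
  have hball' := congrArg ENNReal.toReal hball
  rw [ENNReal.toReal_mul, ENNReal.toReal_ofReal (by positivity)] at hup'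
  rw [ENNReal.toReal_mul, ENNReal.toReal_mul, ENNReal.toReal_ofReal (by positivity),
    ENNReal.toReal_ofReal (by positivity)] at hlow'
  rw [ENNReal.toReal_mul, ENNReal.toReal_ofNat] at hball'
  rw [sphereUniform_cap hx, hpow, ENNReal.toReal_div]
  simp only [← measureReal_def] at *
  push_cast
  constructor
  · rw [div_le_div_iff₀ (by positivity) hB]
    calc _ = a ^ n * (1 / ((n : ℝ) + 1)) *
          (((n : ℝ) + 1) * volume.real (ball (0 : EuclideanSpace ℝ (Fin (n + 1))) 1)) := by
          field_simp
      _ ≤ a ^ n * (1 / ((n : ℝ) + 1)) * (√(2 * (n + 1) * π) *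
          volume.real (ball (0 : EuclideanSpace ℝ (Fin n)) 1)) := by gcongr
      _ = a ^ n * (1 / ((n : ℝ) + 1) * volume.real (ball (0 : EuclideanSpace ℝ (Fin n)) 1)) *
          √(2 * (n + 1) * π) := by ring
      _ ≤ _ := by gcongr
  · rw [div_le_div_iff₀ hB two_pos, hball']
    linarith
end
end
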